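/- Let X be a Banach space and α < ω₁. Then X has the α-bush property if and only if D(X) > α, i.e., there exists ε > 0 with d_ε^α(B_X) ≠ ∅. -/

import Mathlib

open Metric Set Topology

noncomputable section

/-- Transfinite iteration of a derivation `d` starting from `a`;
meets are taken at limit stages. -/
def derivIter {L : Type*} [CompleteLattice L] (d : L → L) (a : L) (α : Ordinal) : L :=
  Ordinal.limitRecOn α a (fun _ ih => d ih) (fun o _ ih => ⨅ (γ : Ordinal) (h : γ < o), ih γ h)

/-- The weak topology of a real normed space. -/
def weakTop (X : Type*) [NormedAddCommGroup X] [NormedSpace ℝ X] : TopologicalSpace X :=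
  TopologicalSpace.induced (fun (x : X) (f : X →L[ℝ] ℝ) => f x) inferInstance

variable {X : Type*} [NormedAddCommGroup X] [NormedSpace ℝ X]

/-- The dentability derivation `d_ε^1`. -/
def dentDeriv (ε : ℝ) (C : Set X) : Set X :=
  C \ ⋃ (f : X →L[ℝ] ℝ) (a : ℝ) (_ : Metric.diam ({y | a < f y} ∩ C) < ε), {y | a < f y}

/-- The weak fragmentation derivation `σ_ε^1`. -/
def weakDeriv (ε : ℝ) (C : Set X) : Set X :=
  C \ ⋃ (V : Set X) (_ : IsOpen[weakTop X] V) (_ : Metric.diam (V ∩ C) < ε), V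

/-- The convex weak fragmentation derivation `γ_ε^1`. -/
def convDeriv (ε : ℝ) (C : Set X) : Set X :=
  closure (convexHull ℝ (weakDeriv ε C))

/-- `treeRoot C δ α x` : `x` is the root of a `δ`-`α`-tree contained in `C`. -/
def treeRoot (C : Set X) (δ : ℝ) (α : Ordinal) : X → Prop :=
  Ordinal.limitRecOn α (fun x => x ∈ C)
    (fun _ ih x => x ∈ C ∧ ∃ y z : X,
      x = (2⁻¹ : ℝ) • (y + z) ∧ δ ≤ 2⁻¹ * ‖y - z‖ ∧ ih y ∧ ih z)
    (fun o _ ih x => ∀ γ (h : γ < o), ih γ h x)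

/-- `sprawlRoot C δ α x` : `x` is the root of a `δ`-`α`-sprawling tree contained in `C`. -/
def sprawlRoot (C : Set X) (δ : ℝ) (α : Ordinal) : X → Prop :=
  Ordinal.limitRecOn α (fun x => x ∈ C)
    (fun _ ih x => x ∈ C ∧ ∃ y z : ℕ → X,
      (∀ n, x = (2⁻¹ : ℝ) • (y n + z n)) ∧
      (∀ n m, n ≠ m → δ ≤ ‖y n - y m‖) ∧
      (∀ n, ih (y n)) ∧ (∀ n, ih (z n)))
    (fun o _ ih x => ∀ γ (h : γ < o), ih γ h x)

/-- `bushRoot C δ α x` : `x` is the root of a `δ`-`α`-bush contained in `C`. -/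
def bushRoot (C : Set X) (δ : ℝ) (α : Ordinal) : X → Prop :=
  Ordinal.limitRecOn α (fun x => x ∈ C)
    (fun _ ih x => x ∈ C ∧ ∃ (n : ℕ) (y : Fin (n + 1) → X) (lam : Fin (n + 1) → ℝ),
      (∀ i, 0 < lam i ∧ lam i ≤ 1) ∧ (∑ i, lam i = 1) ∧
      x = ∑ i, lam i • y i ∧ (∀ i, δ ≤ ‖x - y i‖) ∧ ∀ i, ih (y i))
    (fun o _ ih x => ∀ γ (h : γ < o), ih γ h x)

/-- `X` has the Slice Point of Continuity Property. -/
def SlicePCP (X : Type*) [NormedAddCommGroup X] [NormedSpace ℝ X] : Prop :=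
  ∀ A : Set X, A.Nonempty → Bornology.IsBounded A → ∀ ε > (0 : ℝ),
    ∃ (f : X →L[ℝ] ℝ) (a : ℝ), ({y | a < f y} ∩ A).Nonempty ∧
      ∀ x ∈ {y | a < f y} ∩ A, ∃ V ∈ @nhds X (weakTop X) x, Metric.diam (V ∩ A) < ε

theorem derivIter_zero {L : Type*} [CompleteLattice L] (d : L → L) (a : L) :
    derivIter d a 0 = a :=
  Ordinal.limitRecOn_zero ..

theorem derivIter_add_one {L : Type*} [CompleteLattice L] (d : L → L) (a : L) (α : Ordinal) :
    derivIter d a (α + 1) = d (derivIter d a α) :=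
  Ordinal.limitRecOn_add_one ..

theorem derivIter_limit {L : Type*} [CompleteLattice L] (d : L → L) (a : L) {α : Ordinal}
    (hα : Order.IsSuccLimit α) : derivIter d a α = ⨅ (γ : Ordinal) (_ : γ < α), derivIter d a γ :=
  Ordinal.limitRecOn_limit _ _ _ _ hα

theorem bushRoot_zero {C : Set X} {δ : ℝ} {x : X} : bushRoot C δ 0 x ↔ x ∈ C := by
  rw [bushRoot, Ordinal.limitRecOn_zero]

theorem bushRoot_add_one {C : Set X} {δ : ℝ} {α : Ordinal} {x : X} :
    bushRoot C δ (α + 1) x ↔ x ∈ C ∧ ∃ (n : ℕ) (y : Fin (n + 1) → X) (lam : Fin (n + 1) → ℝ),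
      (∀ i, 0 < lam i ∧ lam i ≤ 1) ∧ (∑ i, lam i = 1) ∧
      x = ∑ i, lam i • y i ∧ (∀ i, δ ≤ ‖x - y i‖) ∧ ∀ i, bushRoot C δ α (y i) := by
  rw [bushRoot, Ordinal.limitRecOn_add_one]
  rfl

theorem bushRoot_limit {C : Set X} {δ : ℝ} {α : Ordinal} {x : X} (hα : Order.IsSuccLimit α) :
    bushRoot C δ α x ↔ ∀ γ < α, bushRoot C δ γ x := by
  rw [bushRoot, Ordinal.limitRecOn_limit _ _ _ _ hα]
  rfl

theorem mem_dentDeriv {ε : ℝ} {C : Set X} {x : X} :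
    x ∈ dentDeriv ε C ↔ x ∈ C ∧ ∀ (f : X →L[ℝ] ℝ) (a : ℝ),
      a < f x → ε ≤ Metric.diam ({y | a < f y} ∩ C) := by
  simp only [dentDeriv, mem_sdiff, mem_iUnion, mem_ofPred_eq, not_exists, exists_prop, not_and]
  exact and_congr_right fun _ => forall₂_congr fun f a =>
    ⟨fun h ha => not_lt.1 fun hd => h hd ha, fun h hd ha => (h ha).not_gt hd⟩

theorem dentDeriv_subset (ε : ℝ) (C : Set X) : dentDeriv ε C ⊆ C :=
  sdiff_subset

theorem Convex.dentDeriv {C : Set X} (hC : Convex ℝ C) (ε : ℝ) : Convex ℝ (dentDeriv ε C) := by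
  have : _root_.dentDeriv ε C = C ∩ ⋂ (f : X →L[ℝ] ℝ) (a : ℝ)
      (_ : Metric.diam ({y | a < f y} ∩ C) < ε), {y | f y ≤ a} := by
    ext x
    simp only [_root_.dentDeriv, mem_sdiff, mem_iUnion, mem_inter_iff, mem_iInter, mem_ofPred_eq,
      not_exists, not_lt]
  rw [this]
  exact hC.inter <| convex_iInter fun f => convex_iInter fun a => convex_iInter fun _ =>
    convex_halfSpace_le f.toLinearMap.isLinear a

theorem derivIter_dentDeriv_subset (ε : ℝ) (C : Set X) (α : Ordinal) :
    derivIter (dentDeriv ε) C α ⊆ C := by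
  induction α using Ordinal.limitRecOn with
  | zero => rw [derivIter_zero]
  | add_one α ih =>
    rw [derivIter_add_one]
    exact (dentDeriv_subset ε _).trans ih
  | limit α hα ih =>
    rw [derivIter_limit _ _ hα]
    exact (iInf₂_le 0 hα.bot_lt).trans (ih 0 hα.bot_lt)

theorem Convex.derivIter_dentDeriv {C : Set X} (hC : Convex ℝ C) (ε : ℝ) (α : Ordinal) :
    Convex ℝ (derivIter (_root_.dentDeriv ε) C α) := by
  induction α using Ordinal.limitRecOn with
  | zero => rwa [derivIter_zero]
  | add_one α ih =>
    rw [derivIter_add_one]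
    exact ih.dentDeriv ε
  | limit α hα ih =>
    rw [derivIter_limit _ _ hα]
    exact convex_iInter₂ ih

/-- The root of a bush in a bounded convex set survives the corresponding derivations. -/
theorem bushRoot.mem_derivIter {C : Set X} (hC : Convex ℝ C) (hb : Bornology.IsBounded C)
    {δ : ℝ} {α : Ordinal} {x : X} (hx : bushRoot C δ α x) :
    x ∈ derivIter (dentDeriv δ) C α := by
  induction α using Ordinal.limitRecOn generalizing x with
  | zero =>
    rw [derivIter_zero]
    exact bushRoot_zero.1 hx
  | add_one α ih =>
    obtain ⟨-, n, y, lam, hlam, hsum, hxy, hd, hy⟩ := bushRoot_add_one.1 hx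
    have hxD : x ∈ derivIter (dentDeriv δ) C α := by
      rw [hxy]
      exact (hC.derivIter_dentDeriv δ α).sum_mem (fun i _ => (hlam i).1.le) hsum
        fun i _ => ih (hy i)
    rw [derivIter_add_one, mem_dentDeriv]
    refine ⟨hxD, fun f a ha => ?_⟩
    obtain ⟨i, hi⟩ : ∃ i, a < f (y i) := by
      by_contra! h
      have hle : f x ≤ a := by
        have := (convex_halfSpace_le f.toLinearMap.isLinear a).sum_mem
          (fun i (_ : i ∈ Finset.univ) => (hlam i).1.le) hsum fun i _ => h i
        rwa [← hxy] at this
      exact hle.not_gt ha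
    calc δ ≤ dist x (y i) := by rw [dist_eq_norm]; exact hd i
      _ ≤ _ := Metric.dist_le_diam_of_mem
        (hb.subset (inter_subset_right.trans (derivIter_dentDeriv_subset δ C α)))
        ⟨ha, hxD⟩ ⟨hi, ih (hy i)⟩
  | limit α hα ih =>
    rw [derivIter_limit _ _ hα]
    exact mem_iInter₂.2 fun γ hγ => ih γ hγ ((bushRoot_limit hα).1 hx γ hγ)

/-- A point surviving the dentability derivation is a limit of convex combinations of points that
are far from it. -/
theorem mem_closure_convexHull_of_mem_dentDeriv {ε r : ℝ} {C : Set X} {x : X} (hr : 0 ≤ r)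
    (hrε : 2 * r < ε) (hx : x ∈ dentDeriv ε C) :
    x ∈ closure (convexHull ℝ (C \ ball x r)) := by
  by_contra h
  obtain ⟨f, u, hfu, hux⟩ :=
    geometric_hahn_banach_closed_point (convex_convexHull ℝ (C \ ball x r)).closure
      isClosed_closure h
  have hsub : {y | u < f y} ∩ C ⊆ ball x r := by
    rintro y ⟨hy, hyC⟩
    by_contra hyx
    exact (hfu y (subset_closure (subset_convexHull ℝ _ ⟨hyC, hyx⟩))).not_gt hy
  have := (mem_dentDeriv.1 hx).2 f u hux
  have := (Metric.diam_mono hsub isBounded_ball).trans (diam_ball hr)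
  linarith

theorem exists_fin_convexCombination_of_mem_convexHull {s : Set X} {x : X}
    (hx : x ∈ convexHull ℝ s) :
    ∃ (n : ℕ) (y : Fin (n + 1) → X) (lam : Fin (n + 1) → ℝ),
      (∀ i, 0 < lam i ∧ lam i ≤ 1) ∧ ∑ i, lam i = 1 ∧ ∑ i, lam i • y i = x ∧ ∀ i, y i ∈ s := by
  obtain ⟨ι, _, z, w, hz, -, hw, hsum, hxz⟩ := eq_pos_convex_span_of_mem_convexHull hx
  have : Nonempty ι := by
    by_contra h
    rw [not_nonempty_iff] at h
    simp at hsum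
  obtain ⟨n, hn⟩ := Nat.exists_eq_add_one.2 (Fintype.card_pos (α := ι))
  let e : Fin (n + 1) ≃ ι := (Fintype.equivFinOfCardEq hn).symm
  refine ⟨n, z ∘ e, w ∘ e, fun i => ⟨hw _, ?_⟩, ?_, ?_, fun i => hz (mem_range_self _)⟩
  · rw [← hsum]
    exact Finset.single_le_sum (fun j _ => (hw j).le) (Finset.mem_univ (e i))
  · rw [← hsum]
    exact e.sum_comp w
  · rw [← hxz]
    exact e.sum_comp fun i => w i • z i

/-- Every sufficiently small perturbation of a point surviving `α` derivations is, after halving,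
the root of a bush: the approximation error made at a node is passed on to all its successors. -/
theorem bushRoot_of_mem_derivIter {ε η : ℝ} (hη : η ≤ 1) (hηε : 8 * η ≤ ε) (hε : 0 < ε)
    {α : Ordinal} {x e : X} (hx : x ∈ derivIter (dentDeriv ε) (closedBall (0 : X) 1) α)
    (he : ‖e‖ < η) :
    bushRoot (closedBall (0 : X) 1) (ε / 16) α ((2⁻¹ : ℝ) • (x + e)) := by
  have hmem : ∀ {x e : X}, x ∈ closedBall (0 : X) 1 → ‖e‖ < η →
      (2⁻¹ : ℝ) • (x + e) ∈ closedBall (0 : X) 1 := by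
    intro x e hx he
    rw [mem_closedBall_zero_iff] at hx ⊢
    rw [norm_smul, Real.norm_of_nonneg (by norm_num)]
    linarith [norm_add_le x e]
  induction α using Ordinal.limitRecOn generalizing x e with
  | zero =>
    rw [derivIter_zero] at hx
    exact bushRoot_zero.2 (hmem hx he)
  | add_one α ih =>
    have hxC := derivIter_dentDeriv_subset ε _ _ hx
    rw [derivIter_add_one] at hx
    obtain ⟨p, hp, hxp⟩ := Metric.mem_closure_iff.1
      (mem_closure_convexHull_of_mem_dentDeriv (r := ε / 4) (by positivity) (by linarith) hx)
      (η - ‖e‖) (sub_pos.2 he)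
    rw [dist_eq_norm] at hxp
    obtain ⟨n, y, lam, hlam, hsum, hyp, hy⟩ := exists_fin_convexCombination_of_mem_convexHull hp
    refine bushRoot_add_one.2 ⟨hmem hxC he, n, fun i => (2⁻¹ : ℝ) • (y i + (e + (x - p))), lam,
      hlam, hsum, ?_, fun i => ?_, fun i => ih (hy i).1 ?_⟩
    · simp_rw [smul_comm _ (2⁻¹ : ℝ)]
      rw [← Finset.smul_sum]
      simp_rw [smul_add _ (y _)]
      rw [Finset.sum_add_distrib, hyp, ← Finset.sum_smul, hsum, one_smul]
      congr 1
      abel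
    · have hfar : ε / 4 ≤ ‖x - y i‖ := by
        have := (hy i).2
        rwa [mem_ball', not_lt, dist_eq_norm] at this
      have heq : (2⁻¹ : ℝ) • (x + e) - (2⁻¹ : ℝ) • (y i + (e + (x - p))) =
          (2⁻¹ : ℝ) • ((x - y i) - (x - p)) := by
        rw [← smul_sub]
        congr 1
        abel
      rw [heq, norm_smul, Real.norm_of_nonneg (by norm_num)]
      linarith [norm_sub_norm_le (x - y i) (x - p), norm_nonneg e]
    · linarith [norm_add_le e (x - p)]
  | limit α hα ih =>
    rw [derivIter_limit _ _ hα] at hx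
    exact (bushRoot_limit hα).2 fun γ hγ => ih γ hγ (mem_iInter₂.1 hx γ hγ) he

/-- For a Banach space `X` and `α < ω₁`: `X` has the `α`-bush property
(for some `δ > 0`, `B_X` contains a `δ`-`α`-bush) iff `D(X) > α`, i.e. there exists `ε > 0`
with `d_ε^α(B_X) ≠ ∅`. -/
theorem statement12 {X : Type*} [NormedAddCommGroup X] [NormedSpace ℝ X] [CompleteSpace X]
    (α : Ordinal) (hα : α < (Cardinal.aleph 1).ord) :
    (∃ δ > (0 : ℝ), ∃ x : X, bushRoot (Metric.closedBall (0 : X) 1) δ α x) ↔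
      (∃ ε > (0 : ℝ), (derivIter (dentDeriv ε) (Metric.closedBall (0 : X) 1) α).Nonempty) := by
  constructor
  · rintro ⟨δ, hδ, x, hx⟩
    exact ⟨δ, hδ, x, hx.mem_derivIter (convex_closedBall 0 1) isBounded_closedBall⟩
  · rintro ⟨ε, hε, x, hx⟩
    have hη : 0 < min 1 (ε / 8) := by positivity
    exact ⟨ε / 16, by positivity, _, bushRoot_of_mem_derivIter (e := 0) (min_le_left _ _)
      (by linarith [min_le_right 1 (ε / 8)]) hε hx (by simpa using hη)⟩
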